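/- Antisymmetry of the intersection number: for any two continuous paths of Lagrangian subspaces L1, L2 of a real symplectic vector space (E, ω) on [a,b], the intersection numbers satisfy [L1 : L2] + [L2 : L1] = 0. -/

import Mathlib

open LinearMap (BilinForm)

variable {E : Type*} [NormedAddCommGroup E] [NormedSpace ℝ E]

/-- A subspace is Lagrangian iff it equals its symplectic orthogonal. -/
def IsLagrangian (ω : BilinForm ℝ E) (L : Submodule ℝ E) : Prop :=
  LinearMap.BilinForm.orthogonal ω L = L

/-- Maximal dimension of a subspace on which the function `Q` is positive away from `0`. -/
noncomputable def posIndex {V : Type*} [AddCommGroup V] [Module ℝ V] (Q : V → ℝ) : ℕ :=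
  sSup {d : ℕ | ∃ W : Submodule ℝ V, Module.finrank ℝ W = d ∧ ∀ x ∈ W, x ≠ 0 → 0 < Q x}

/-- The quadratic form `Q(L1,L2,L3)` of a triplet of subspaces,
`Q(x1,x2,x3) = ω(x1,x2) + ω(x2,x3) + ω(x3,x1)`. -/
def tripleQ (ω : BilinForm ℝ E) (L1 L2 L3 : Submodule ℝ E) (v : L1 × L2 × L3) : ℝ :=
  ω v.1 v.2.1 + ω v.2.1 v.2.2 + ω v.2.2 v.1

/-- The signature `s(L1,L2,L3)` of a triplet of subspaces: the signature (number of positive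
squares minus number of negative squares in a diagonalization) of `Q(L1,L2,L3)`. -/
noncomputable def tripleSig (ω : BilinForm ℝ E) (L1 L2 L3 : Submodule ℝ E) : ℤ :=
  (posIndex (tripleQ ω L1 L2 L3) : ℤ) - (posIndex (fun v => - tripleQ ω L1 L2 L3 v) : ℤ)

/-- A continuous path of Lagrangian subspaces of `(E, ω)` on the interval `[a,b]`:  a family
`(L t)` of Lagrangian subspaces such that every `t0 ∈ [a,b]` has a neighbourhood `U` in `[a,b]`
on which there is a continuous family of idempotent linear maps of `E` with range `L t`. -/
structure IsLagrangianPath (ω : BilinForm ℝ E) (a b : ℝ) (L : ℝ → Submodule ℝ E) : Prop where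
  lag : ∀ t ∈ Set.Icc a b, IsLagrangian ω (L t)
  locTriv : ∀ t0 ∈ Set.Icc a b, ∃ U ∈ nhdsWithin t0 (Set.Icc a b), U ⊆ Set.Icc a b ∧
    ∃ P : ℝ → E →L[ℝ] E, ContinuousOn P U ∧
      ∀ t ∈ U, (P t).comp (P t) = P t ∧ LinearMap.range (P t : E →ₗ[ℝ] E) = L t

/-- A jointly continuous two-parameter family `(L s t)`, `s ∈ [0,1]`, `t ∈ [a,b]`, of Lagrangian
subspaces (a homotopy of paths of Lagrangian subspaces). -/
structure IsLagrangianHomotopy (ω : BilinForm ℝ E) (a b : ℝ)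
    (L : ℝ → ℝ → Submodule ℝ E) : Prop where
  lag : ∀ s ∈ Set.Icc (0:ℝ) 1, ∀ t ∈ Set.Icc a b, IsLagrangian ω (L s t)
  locTriv : ∀ p ∈ Set.Icc (0:ℝ) 1 ×ˢ Set.Icc a b,
    ∃ U ∈ nhdsWithin p (Set.Icc (0:ℝ) 1 ×ˢ Set.Icc a b),
      U ⊆ Set.Icc (0:ℝ) 1 ×ˢ Set.Icc a b ∧
      ∃ P : ℝ × ℝ → E →L[ℝ] E, ContinuousOn P U ∧
        ∀ q ∈ U, (P q).comp (P q) = P q ∧ LinearMap.range (P q : E →ₗ[ℝ] E) = L q.1 q.2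

/-- Admissible data for a pair of paths of Lagrangian subspaces on `[a,b]`:  a partition
`a = t_0 ≤ t_1 ≤ … ≤ t_k = b` together with Lagrangian subspaces `M_1, …, M_k` such that
`M_ν ∩ L_i(t) = 0` for all `t ∈ [t_{ν-1}, t_ν]`, `i = 1,2`.  (Here `M (ν+1)` plays the role
of `M_{ν+1}` for `0 ≤ ν < k`.) -/
structure AdmissibleData (ω : BilinForm ℝ E) (a b : ℝ) (L1 L2 : ℝ → Submodule ℝ E) where
  k : ℕ
  kpos : 0 < k
  t : ℕ → ℝ
  M : ℕ → Submodule ℝ E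
  ht0 : t 0 = a
  htk : t k = b
  hmono : ∀ ν < k, t ν ≤ t (ν + 1)
  hlag : ∀ ν < k, IsLagrangian ω (M (ν + 1))
  htrans1 : ∀ ν < k, ∀ s ∈ Set.Icc (t ν) (t (ν + 1)), M (ν + 1) ⊓ L1 s = ⊥
  htrans2 : ∀ ν < k, ∀ s ∈ Set.Icc (t ν) (t (ν + 1)), M (ν + 1) ⊓ L2 s = ⊥

/-- The expression `(1/2) Σ_ν ( s(L1(t_{ν-1}), L2(t_{ν-1}), M_ν) − s(L1(t_ν), L2(t_ν), M_ν) )`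
computed from admissible data; by well-definedness this is the intersection number `[L1 : L2]`. -/
noncomputable def dataSum {ω : BilinForm ℝ E} {a b : ℝ} {L1 L2 : ℝ → Submodule ℝ E}
    (D : AdmissibleData ω a b L1 L2) : ℝ :=
  (1 / 2 : ℝ) * ∑ ν ∈ Finset.range D.k,
    ((tripleSig ω (L1 (D.t ν)) (L2 (D.t ν)) (D.M (ν + 1)) : ℝ)
      - (tripleSig ω (L1 (D.t (ν + 1))) (L2 (D.t (ν + 1))) (D.M (ν + 1)) : ℝ))

/-- A continuous path of symplectic automorphisms of `(E, ω)` on `[a,b]`. -/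
structure IsSymplecticPath (ω : BilinForm ℝ E) (a b : ℝ) (A : ℝ → E →L[ℝ] E) : Prop where
  bij : ∀ t ∈ Set.Icc a b, Function.Bijective (A t)
  symp : ∀ t ∈ Set.Icc a b, ∀ x y, ω (A t x) (A t y) = ω x y
  cont : ContinuousOn A (Set.Icc a b)

/-- The symplectic form of `E × E⁻`: `((x1,x2),(y1,y2)) ↦ ω(x1,y1) − ω(x2,y2)`. -/
noncomputable def prodNegForm (ω : BilinForm ℝ E) : BilinForm ℝ (E × E) :=
  LinearMap.mk₂ ℝ (fun x y => ω x.1 y.1 - ω x.2 y.2)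
    (fun x x' y => by simp only [Prod.fst_add, Prod.snd_add, map_add, LinearMap.add_apply]; ring)
    (fun c x y => by
      simp only [Prod.smul_fst, Prod.smul_snd, map_smul, LinearMap.smul_apply, smul_eq_mul]; ring)
    (fun x y y' => by simp only [Prod.fst_add, Prod.snd_add, map_add]; ring)
    (fun c x y => by simp only [Prod.smul_fst, Prod.smul_snd, map_smul, smul_eq_mul]; ring)

/-- The graph `Γ_A = {(A x, x)}` of an endomorphism, as a subspace of `E × E`. -/
def graphSub (A : E →L[ℝ] E) : Submodule ℝ (E × E) :=
  LinearMap.range ((A : E →ₗ[ℝ] E).prod LinearMap.id)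

/-- The diagonal `Δ = {(x, x)}` in `E × E`. -/
def diagSub : Submodule ℝ (E × E) :=
  LinearMap.range ((LinearMap.id : E →ₗ[ℝ] E).prod LinearMap.id)

theorem posIndex_eq_sigPos {V : Type*} [AddCommGroup V] [Module ℝ V] [FiniteDimensional ℝ V]
    (Q : QuadraticForm ℝ V) : posIndex Q = sigPos Q := by
  have h : {d : ℕ | ∃ S : Submodule ℝ V, Module.finrank ℝ S = d ∧ ∀ x ∈ S, x ≠ 0 → 0 < Q x} =
      {d : ℕ | ∃ S : Submodule ℝ V, Module.finrank ℝ S = d ∧ (Q.restrict S).PosDef} := by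
    simp [QuadraticMap.PosDef]
  rw [posIndex, h]
  exact (sigPos_isGreatest Q).csSup_eq

/-- The signature of a real quadratic form. -/
noncomputable def quadSig {V : Type*} [AddCommGroup V] [Module ℝ V] (Q : QuadraticForm ℝ V) : ℤ :=
  (sigPos Q : ℤ) - sigNeg Q

theorem quadSig_neg {V : Type*} [AddCommGroup V] [Module ℝ V] (Q : QuadraticForm ℝ V) :
    quadSig (-Q) = -quadSig Q := by
  simp [quadSig]

section Signature

variable {V W : Type*} [AddCommGroup V] [Module ℝ V] [FiniteDimensional ℝ V]
  [AddCommGroup W] [Module ℝ W] [FiniteDimensional ℝ W]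

theorem le_sigPos {Q : QuadraticForm ℝ V} {S : Submodule ℝ V}
    (hS : ∀ x ∈ S, x ≠ 0 → 0 < Q x) : Module.finrank ℝ S ≤ sigPos Q :=
  le_sigPos_of_posDef Q fun x hx => hS x x.2 (by simpa using hx)

theorem exists_finrank_eq_sigPos (Q : QuadraticForm ℝ V) :
    ∃ S : Submodule ℝ V, Module.finrank ℝ S = sigPos Q ∧ ∀ x ∈ S, x ≠ 0 → 0 < Q x := by
  obtain ⟨S, hS, hpos⟩ := exists_finrank_eq_sigPos_and_posDef Q
  exact ⟨S, hS, fun x hx hx0 => hpos ⟨x, hx⟩ (by simpa using hx0)⟩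

theorem sigPos_comp_of_surjective (Q : QuadraticForm ℝ V) {f : W →ₗ[ℝ] V}
    (hf : Function.Surjective f) : sigPos (Q.comp f) = sigPos Q := by
  apply le_antisymm
  · obtain ⟨S, hS, hpos⟩ := exists_finrank_eq_sigPos (Q.comp f)
    have hinj : Function.Injective (f.domRestrict S) := by
      rw [← LinearMap.ker_eq_bot, LinearMap.ker_eq_bot']
      intro x hx
      by_contra hx0
      have := hpos x x.2 (by simpa using hx0)
      rw [LinearMap.domRestrict_apply] at hx
      simp [hx] at this
    rw [← hS, ← LinearMap.finrank_range_of_inj hinj]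
    apply le_sigPos
    rintro _ ⟨x, rfl⟩ hx0
    refine hpos x x.2 ?_
    rintro h
    simp [h] at hx0
  · obtain ⟨g, hg⟩ := f.exists_rightInverse_of_surjective (LinearMap.range_eq_top.2 hf)
    have hg' : ∀ x, f (g x) = x := fun x => LinearMap.congr_fun hg x
    obtain ⟨S, hS, hpos⟩ := exists_finrank_eq_sigPos Q
    have hinj : Function.Injective (g.domRestrict S) := by
      intro x y h
      have := congrArg f h
      simpa [hg'] using this
    rw [← hS, ← LinearMap.finrank_range_of_inj hinj]
    apply le_sigPos
    rintro _ ⟨x, rfl⟩ hx0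
    simp only [LinearMap.domRestrict_apply, QuadraticMap.comp_apply, hg']
    refine hpos x x.2 ?_
    rintro h
    simp [h] at hx0

theorem quadSig_comp_of_surjective (Q : QuadraticForm ℝ V) {f : W →ₗ[ℝ] V}
    (hf : Function.Surjective f) : quadSig (Q.comp f) = quadSig Q := by
  have h : -(Q.comp f) = (-Q).comp f := rfl
  rw [quadSig, quadSig, ← sigPos_neg, ← sigPos_neg, h, sigPos_comp_of_surjective _ hf,
    sigPos_comp_of_surjective _ hf]

theorem finrank_submodule_prod (S : Submodule ℝ V) (T : Submodule ℝ W) :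
    Module.finrank ℝ (S.prod T) = Module.finrank ℝ S + Module.finrank ℝ T := by
  have h : S.prod T = LinearMap.range (S.subtype.prodMap T.subtype) := by
    simp [LinearMap.range_prodMap]
  rw [h, LinearMap.finrank_range_of_inj, Module.finrank_prod]
  exact S.injective_subtype.prodMap T.injective_subtype

theorem sigPos_add_le_sigPos_prod (Q : QuadraticForm ℝ V) (R : QuadraticForm ℝ W) :
    sigPos Q + sigPos R ≤ sigPos (Q.prod R) := by
  obtain ⟨S, hS, hSpos⟩ := exists_finrank_eq_sigPos Q
  obtain ⟨T, hT, hTpos⟩ := exists_finrank_eq_sigPos R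
  rw [← hS, ← hT, ← finrank_submodule_prod]
  apply le_sigPos
  rintro ⟨x, y⟩ ⟨hx, hy⟩ h0
  rw [QuadraticMap.prod_apply]
  by_cases hx0 : x = 0
  · subst hx0
    simpa using hTpos y hy (by simpa using h0)
  · by_cases hy0 : y = 0
    · subst hy0
      simpa using hSpos x hx hx0
    · exact add_pos (hSpos x hx hx0) (hTpos y hy hy0)

theorem quadSig_prod (Q : QuadraticForm ℝ V) (R : QuadraticForm ℝ W) :
    quadSig (Q.prod R) = quadSig Q + quadSig R := by
  have h1 := sigPos_add_le_sigPos_prod Q R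
  have h2 := sigPos_add_le_sigPos_prod (-Q) (-R)
  have hneg : (-Q).prod (-R) = -(Q.prod R) := by
    ext; simp [add_comm]
  rw [hneg] at h2
  simp only [sigPos_neg] at h2
  have h3 : Module.finrank ℝ Q.radical + Module.finrank ℝ R.radical
      ≤ Module.finrank ℝ (Q.prod R).radical := by
    rw [← finrank_submodule_prod]
    apply Submodule.finrank_mono
    rintro ⟨x, y⟩ ⟨hx, hy⟩
    simp only [SetLike.mem_coe, QuadraticMap.mem_radical_iff'] at hx hy ⊢
    simp [hx.1, hx.2, hy.1, hy.2]
  have h4 := QuadraticForm.sigPos_add_sigNeg_add_radical (Q := Q)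
  have h5 := QuadraticForm.sigPos_add_sigNeg_add_radical (Q := R)
  have h6 := QuadraticForm.sigPos_add_sigNeg_add_radical (Q := Q.prod R)
  rw [Module.finrank_prod] at h6
  simp only [quadSig]
  lia

theorem quadSig_eq_zero_of_comp_eq_neg {Q : QuadraticForm ℝ V} {f : V →ₗ[ℝ] V}
    (hf : Function.Surjective f) (h : Q.comp f = -Q) : quadSig Q = 0 := by
  have h1 := quadSig_comp_of_surjective Q hf
  rw [h, quadSig_neg] at h1
  lia

end Signature

section Symplectic

variable {ω : BilinForm ℝ E}

/-- The quadratic form `(x, y, z) ↦ ω(x, y) + ω(y, z) + ω(z, x)` on `E × E × E`. -/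
noncomputable def cyclicForm (ω : BilinForm ℝ E) : QuadraticForm ℝ (E × E × E) :=
  LinearMap.BilinMap.toQuadraticMap
    (ω.compl₁₂ (.fst ℝ E (E × E)) (.fst ℝ E E ∘ₗ .snd ℝ E (E × E))
      + ω.compl₁₂ (.fst ℝ E E ∘ₗ .snd ℝ E (E × E)) (.snd ℝ E E ∘ₗ .snd ℝ E (E × E))
      + ω.compl₁₂ (.snd ℝ E E ∘ₗ .snd ℝ E (E × E)) (.fst ℝ E (E × E)))

@[simp]
theorem cyclicForm_apply (v : E × E × E) :
    cyclicForm ω v = ω v.1 v.2.1 + ω v.2.1 v.2.2 + ω v.2.2 v.1 := rfl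

theorem polar_cyclicForm (v w : E × E × E) :
    QuadraticMap.polar (cyclicForm ω) v w =
      (ω v.1 w.2.1 + ω v.2.1 w.2.2 + ω v.2.2 w.1)
        + (ω w.1 v.2.1 + ω w.2.1 v.2.2 + ω w.2.2 v.1) := by
  simp only [QuadraticMap.polar, cyclicForm_apply, Prod.fst_add, Prod.snd_add, map_add,
    LinearMap.add_apply]
  ring

/-- The quadratic form `x ↦ ω(p x, x)` on a subspace `B`. -/
noncomputable def sliceForm (ω : BilinForm ℝ E) (p : E →ₗ[ℝ] E) (B : Submodule ℝ E) :
    QuadraticForm ℝ B :=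
  LinearMap.BilinMap.toQuadraticMap (ω.compl₁₂ (p ∘ₗ B.subtype) B.subtype)

@[simp]
theorem sliceForm_apply (p : E →ₗ[ℝ] E) (B : Submodule ℝ E) (x : B) :
    sliceForm ω p B x = ω (p x) x := rfl

theorem IsLagrangian.apply_eq_zero {L : Submodule ℝ E} (hL : IsLagrangian ω L) {x y : E}
    (hx : x ∈ L) (hy : y ∈ L) : ω x y = 0 := by
  rw [← hL] at hy
  exact hy x hx

theorem IsLagrangian.mem_of_forall {L : Submodule ℝ E} (hL : IsLagrangian ω L) {y : E}
    (hy : ∀ x ∈ L, ω x y = 0) : y ∈ L := by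
  rw [← hL]
  exact hy

theorem apply_projection_comm {A B C : Submodule ℝ E} (hA : IsLagrangian ω A)
    (hB : IsLagrangian ω B) (hC : IsLagrangian ω C) (h : IsCompl A C) (halt : LinearMap.IsAlt ω)
    {x y : E} (hx : x ∈ B) (hy : y ∈ B) :
    ω (A.projection C h x) y = ω (A.projection C h y) x := by
  have e1 := hB.apply_eq_zero hx hy
  have e2 := hA.apply_eq_zero (Submodule.projection_apply_mem h x)
    (Submodule.projection_apply_mem h y)
  have e3 := hC.apply_eq_zero (Submodule.sub_projection_mem h x) (Submodule.sub_projection_mem h y)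
  simp only [map_sub, LinearMap.sub_apply] at e3
  rw [← halt.neg x]
  linarith

variable [FiniteDimensional ℝ E]

theorem tripleSig_eq_quadSig (A B C : Submodule ℝ E) :
    tripleSig ω A B C =
      quadSig ((cyclicForm ω).comp (A.subtype.prodMap (B.subtype.prodMap C.subtype))) := by
  rw [quadSig, ← sigPos_neg, ← posIndex_eq_sigPos, ← posIndex_eq_sigPos]
  rfl

theorem tripleSig_swap (halt : LinearMap.IsAlt ω) (A B C : Submodule ℝ E) :
    tripleSig ω B A C = -tripleSig ω A B C := by
  let f : (B × A × C) →ₗ[ℝ] (A × B × C) :=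
    (LinearMap.fst ℝ A C ∘ₗ LinearMap.snd ℝ B (A × C)).prod
      ((LinearMap.fst ℝ B (A × C)).prod (LinearMap.snd ℝ A C ∘ₗ LinearMap.snd ℝ B (A × C)))
  have hf : Function.Surjective f := fun ⟨x, y, z⟩ => ⟨(y, x, z), rfl⟩
  rw [tripleSig_eq_quadSig, tripleSig_eq_quadSig, ← quadSig_neg,
    ← quadSig_comp_of_surjective (-_) hf]
  congr 1
  ext ⟨x, y, z⟩
  simp only [QuadraticMap.comp_apply, neg_apply, cyclicForm_apply,
    LinearMap.prodMap_apply, Submodule.subtype_apply, f, LinearMap.prod_apply, Function.prod_apply,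
    LinearMap.comp_apply, LinearMap.fst_apply, LinearMap.snd_apply]
  rw [← halt.neg (x : E) y, ← halt.neg (z : E) x, ← halt.neg (y : E) z]
  ring

theorem IsLagrangian.two_mul_finrank
    (hnd : LinearMap.BilinForm.Nondegenerate ω) {L : Submodule ℝ E} (hL : IsLagrangian ω L) :
    2 * Module.finrank ℝ L = Module.finrank ℝ E := by
  have h := LinearMap.BilinForm.finrank_orthogonal hnd L
  rw [show ω.orthogonal L = L from hL] at h
  have := Submodule.finrank_le L
  lia

theorem IsLagrangian.isCompl
    (hnd : LinearMap.BilinForm.Nondegenerate ω) {L M : Submodule ℝ E} (hL : IsLagrangian ω L)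
    (hM : IsLagrangian ω M) (h : M ⊓ L = ⊥) : IsCompl L M := by
  refine (Submodule.isCompl_iff_disjoint _ _ ?_).2 (disjoint_iff.2 (inf_comm L M ▸ h))
  have := hL.two_mul_finrank hnd
  have := hM.two_mul_finrank hnd
  lia

theorem tripleSig_eq_quadSig_sliceForm (halt : LinearMap.IsAlt ω) {A B C : Submodule ℝ E}
    (hA : IsLagrangian ω A) (hC : IsLagrangian ω C) (h : IsCompl A C) :
    tripleSig ω A B C = quadSig (sliceForm ω (A.projection C h) B) := by
  let hyp : QuadraticForm ℝ (A × C) := LinearMap.BilinMap.toQuadraticMap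
    (ω.compl₁₂ (A.subtype ∘ₗ .fst ℝ A C) (C.subtype ∘ₗ .snd ℝ A C))
  have hyp_zero : quadSig hyp = 0 := by
    refine quadSig_eq_zero_of_comp_eq_neg (f := (-LinearMap.id).prodMap LinearMap.id)
      (fun ⟨x, y⟩ => ⟨(-x, y), by simp⟩) ?_
    ext ⟨x, y⟩
    simp [hyp]
  let p := A.projectionOnto C h
  let r := C.projectionOnto A h.symm
  have hpr (x : E) : (r x : E) = x - p x :=
    Submodule.projection_eq_self_sub_projection h x
  let f : (B × A × C) →ₗ[ℝ] (A × B × C) :=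
    (p ∘ₗ B.subtype ∘ₗ .fst ℝ B (A × C) - .fst ℝ A C ∘ₗ .snd ℝ B (A × C)).prod
      ((LinearMap.fst ℝ B (A × C)).prod
        (.snd ℝ A C ∘ₗ .snd ℝ B (A × C) + r ∘ₗ B.subtype ∘ₗ .fst ℝ B (A × C)))
  have hf : Function.Surjective f := fun ⟨x, y, z⟩ => ⟨(y, p y - x, z - r y), by simp [f]⟩
  rw [tripleSig_eq_quadSig, ← quadSig_comp_of_surjective _ hf,
    ← add_zero (quadSig (sliceForm _ _ _)), ← hyp_zero, ← quadSig_prod]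
  congr 1
  ext ⟨y, u, m⟩
  simp only [QuadraticMap.comp_apply, QuadraticMap.prod_apply, cyclicForm_apply,
    LinearMap.prodMap_apply, Submodule.subtype_apply, f, LinearMap.prod_apply, Function.prod_apply,
    LinearMap.comp_apply, LinearMap.fst_apply, LinearMap.snd_apply, LinearMap.sub_apply,
    LinearMap.add_apply, hyp, sliceForm_apply,
    LinearMap.BilinMap.toQuadraticMap_apply, LinearMap.compl₁₂_apply, hpr, map_add, map_sub,
    Submodule.projection_apply]
  have e1 := hA.apply_eq_zero (p y).2 (p y).2
  have e2 := hA.apply_eq_zero (p y).2 u.2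
  have e3 := halt (y : E)
  have e4 := halt.neg (y : E) m
  have e5 := halt.neg (y : E) (p y)
  have e6 := halt.neg (u : E) m
  have e7 := halt.neg (m : E) (p y)
  have e8 := halt.neg (u : E) y
  have e9 := hC.apply_eq_zero (r y).2 m.2
  rw [hpr] at e9
  simp only [map_sub, LinearMap.sub_apply] at e9
  linarith

end Symplectic

section Cocycle

variable {ω : BilinForm ℝ E} [FiniteDimensional ℝ E]

theorem tripleSig_add_tripleSig (halt : LinearMap.IsAlt ω)
    (hnd : LinearMap.BilinForm.Nondegenerate ω) {A B C D : Submodule ℝ E}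
    (hA : IsLagrangian ω A) (hB : IsLagrangian ω B) (hC : IsLagrangian ω C)
    (hD : IsLagrangian ω D) (hCA : C ⊓ A = ⊥) (hCB : C ⊓ B = ⊥) (hDA : D ⊓ A = ⊥) :
    tripleSig ω A B C + tripleSig ω B D C = tripleSig ω A D C + tripleSig ω A B D := by
  have hAC := hA.isCompl hnd hC hCA
  have hBC := hB.isCompl hnd hC hCB
  have hAD := hA.isCompl hnd hD hDA
  rw [tripleSig_eq_quadSig_sliceForm halt hA hC hAC, tripleSig_eq_quadSig_sliceForm halt hB hC hBC,
    tripleSig_eq_quadSig_sliceForm halt hA hC hAC, tripleSig_eq_quadSig_sliceForm halt hA hD hAD,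
    add_comm (quadSig (sliceForm ω _ D)), ← quadSig_prod, ← quadSig_prod]
  let p := A.projection C hAC
  let F : QuadraticForm ℝ (B × D) := LinearMap.BilinMap.toQuadraticMap
    (ω.compl₁₂ (p ∘ₗ B.subtype ∘ₗ .fst ℝ B D) (B.subtype ∘ₗ .fst ℝ B D)
      - (2 : ℝ) • ω.compl₁₂ (p ∘ₗ D.subtype ∘ₗ .snd ℝ B D) (B.subtype ∘ₗ .fst ℝ B D)
      + ω.compl₁₂ (p ∘ₗ D.subtype ∘ₗ .snd ℝ B D) (D.subtype ∘ₗ .snd ℝ B D))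
  have F_apply (x : B) (y : D) : F (x, y) = ω (p x) x - 2 * ω (p y) x + ω (p y) y := rfl
  let f : (B × D) →ₗ[ℝ] (B × D) :=
    (LinearMap.fst ℝ B D + B.projectionOnto C hBC ∘ₗ D.subtype ∘ₗ .snd ℝ B D).prod (.snd ℝ B D)
  let g : (B × D) →ₗ[ℝ] (B × D) :=
    (LinearMap.fst ℝ B D).prod
      (.snd ℝ B D + D.projectionOnto A hAD.symm ∘ₗ B.subtype ∘ₗ .fst ℝ B D)
  have hf : Function.Surjective f :=
    fun ⟨x, y⟩ => ⟨(x - B.projectionOnto C hBC y, y), by simp [f]⟩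
  have hg : Function.Surjective g :=
    fun ⟨x, y⟩ => ⟨(x, y - D.projectionOnto A hAD.symm x), by simp [g]⟩
  have hFf : F.comp f = (sliceForm ω p B).prod (sliceForm ω (B.projection C hBC) D) := by
    ext ⟨x, y⟩
    set r := B.projectionOnto C hBC y
    have hyr : (y : E) - r ∈ C := Submodule.sub_projection_mem hBC y
    have hpr : p r = p y := by
      rw [← sub_eq_zero, ← map_sub]
      refine (Submodule.projection_apply_eq_zero_iff hAC).2 ?_
      rw [← neg_sub]
      exact C.neg_mem hyr
    have e1 : ω (p x) r = ω (p y) x := by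
      rw [← hpr]
      exact apply_projection_comm hA hB hC hAC halt x.2 r.2
    have e2 := hC.apply_eq_zero (Submodule.sub_projection_mem hAC (y : E)) hyr
    have e3 := halt (y : E)
    have e4 := halt.neg (y : E) r
    change F (x + r, y) = ω (p x) x + ω r y
    change ω ((y : E) - p y) (y - r) = 0 at e2
    simp only [map_sub, LinearMap.sub_apply] at e2
    simp only [F_apply, Submodule.coe_add, map_add, LinearMap.add_apply, hpr]
    linarith
  have hFg : F.comp g = (sliceForm ω (A.projection D hAD) B).prod (sliceForm ω p D) := by
    ext ⟨x, y⟩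
    set r := D.projectionOnto A hAD.symm x
    have hxr : (x : E) - r ∈ A := Submodule.sub_projection_mem hAD.symm x
    have hpr : p x - p r = x - r := by
      rw [← map_sub]
      exact Submodule.projection_apply_of_mem_left hAC hxr
    have hq : A.projection D hAD x = x - r :=
      Submodule.projection_eq_self_sub_projection hAD.symm x
    have e1 : ω (p r) y = ω (p y) r := apply_projection_comm hA hD hC hAC halt r.2 y.2
    have e2 := hA.apply_eq_zero (Submodule.projection_apply_mem hAC (y : E)) hxr
    have e3 := hA.apply_eq_zero (Submodule.projection_apply_mem hAC (r : E)) hxr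
    change F (x, y + r) = ω (A.projection D hAD x) x + ω (p y) y
    change ω (p y) (x - r) = 0 at e2
    change ω (p r) (x - r) = 0 at e3
    rw [hq, ← hpr]
    simp only [map_sub] at e2 e3
    simp only [F_apply, Submodule.coe_add, map_add, LinearMap.add_apply, map_sub,
      LinearMap.sub_apply]
    linarith
  rw [← hFf, ← hFg, quadSig_comp_of_surjective _ hf, quadSig_comp_of_surjective _ hg]

end Cocycle

section Continuity

variable {ω : BilinForm ℝ E}

/-- The pull-back of `cyclicForm ω` to `E × M × N` along `A : E → E` and the inclusions. -/
noncomputable def pullbackForm (ω : BilinForm ℝ E) (M N : Submodule ℝ E) (A : E →L[ℝ] E) :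
    QuadraticForm ℝ (E × M × N) :=
  (cyclicForm ω).comp ((A : E →ₗ[ℝ] E).prodMap (M.subtype.prodMap N.subtype))

theorem radical_pullbackForm (halt : LinearMap.IsAlt ω) {M N : Submodule ℝ E} {A : E →L[ℝ] E}
    (hA : IsLagrangian ω (LinearMap.range (A : E →ₗ[ℝ] E))) (hM : IsLagrangian ω M)
    (hN : IsLagrangian ω N) (hMA : M ⊓ LinearMap.range (A : E →ₗ[ℝ] E) = ⊥)
    (hNA : N ⊓ LinearMap.range (A : E →ₗ[ℝ] E) = ⊥) :
    (pullbackForm ω M N A).radical = (LinearMap.ker (A : E →ₗ[ℝ] E)).prod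
      (LinearMap.eqLocus (M.subtype ∘ₗ .fst ℝ M N) (N.subtype ∘ₗ .snd ℝ M N)) := by
  rw [QuadraticMap.radical_eq_ker_polarBilin]
  ext ⟨x, m, n⟩
  have hpolar (y : E) (m' : M) (n' : N) : (pullbackForm ω M N A).polarBilin (x, m, n) (y, m', n') =
      (ω (A x) m' + ω m n' + ω n (A y)) + (ω (A y) m + ω m' n + ω n' (A x)) := by
    rw [pullbackForm, QuadraticMap.polarBilin_comp]
    exact polar_cyclicForm (A x, (m : E), (n : E)) (A y, (m' : E), (n' : E))
  have hAmem (y : E) : A y ∈ LinearMap.range (A : E →ₗ[ℝ] E) := ⟨y, rfl⟩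
  simp only [Submodule.mem_prod, LinearMap.mem_ker, LinearMap.mem_eqLocus, LinearMap.comp_apply,
    LinearMap.fst_apply, LinearMap.snd_apply, Submodule.subtype_apply, ContinuousLinearMap.coe_coe]
  constructor
  · intro h
    have h' (y : E) (m' : M) (n' : N) := (hpolar y m' n').symm.trans (LinearMap.congr_fun h _)
    simp only [LinearMap.zero_apply] at h'
    have h1 : (m : E) - n ∈ LinearMap.range (A : E →ₗ[ℝ] E) := by
      refine hA.mem_of_forall ?_
      rintro _ ⟨y, rfl⟩
      have e1 := h' y 0 0
      have e2 := halt.neg (A y) n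
      simp only [map_zero, LinearMap.zero_apply, ZeroMemClass.coe_zero, zero_add, add_zero] at e1
      simp only [map_sub, ContinuousLinearMap.coe_coe]
      linarith
    have h2 : (n : E) - A x ∈ M := by
      refine hM.mem_of_forall fun m' hm' => ?_
      have e1 := h' 0 ⟨m', hm'⟩ 0
      have e2 := halt.neg (A x) m'
      simp only [map_zero, LinearMap.zero_apply, ZeroMemClass.coe_zero, zero_add, add_zero] at e1
      simp only [map_sub]
      linarith
    have h3 : (m : E) - A x ∈ N := by
      refine hN.mem_of_forall fun n' hn' => ?_
      have e1 := h' 0 0 ⟨n', hn'⟩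
      have e2 := halt.neg (m : E) n'
      simp only [map_zero, LinearMap.zero_apply, ZeroMemClass.coe_zero, zero_add, add_zero] at e1
      simp only [map_sub]
      linarith
    have h4 : A x + (m - n) = 0 := by
      rw [← Submodule.mem_bot ℝ, ← hMA]
      refine Submodule.mem_inf.2 ⟨?_, Submodule.add_mem _ (hAmem x) h1⟩
      rw [show A x + ((m : E) - n) = m - (n - A x) by abel]
      exact M.sub_mem m.2 h2
    have h5 : A x - (m - n) = 0 := by
      rw [← Submodule.mem_bot ℝ, ← hNA]
      refine Submodule.mem_inf.2 ⟨?_, Submodule.sub_mem _ (hAmem x) h1⟩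
      rw [show A x - ((m : E) - n) = n - (m - A x) by abel]
      exact N.sub_mem n.2 h3
    have h6 : A x = 0 := by
      have : (2 : ℝ) • A x = 0 := by
        rw [two_smul]
        calc A x + A x = (A x + (m - n)) + (A x - (m - n)) := by abel
          _ = 0 := by rw [h4, h5, add_zero]
      simpa using this
    refine ⟨h6, ?_⟩
    rwa [h6, zero_add, sub_eq_zero] at h4
  · rintro ⟨hx, hmn⟩
    refine LinearMap.ext fun ⟨y, m', n'⟩ => ?_
    rw [hpolar, hx]
    have e1 := halt.neg (m : E) (A y)
    have e2 := hM.apply_eq_zero m'.2 m.2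
    have e3 := hN.apply_eq_zero n.2 n'.2
    rw [← hmn] at e3 ⊢
    simp only [map_zero, LinearMap.zero_apply]
    linarith

variable [FiniteDimensional ℝ E]

theorem quadSig_pullbackForm (M N : Submodule ℝ E) (A : E →L[ℝ] E) :
    quadSig (pullbackForm ω M N A) = tripleSig ω (LinearMap.range (A : E →ₗ[ℝ] E)) M N := by
  let f : (E × M × N) →ₗ[ℝ] (LinearMap.range (A : E →ₗ[ℝ] E) × M × N) :=
    (A : E →ₗ[ℝ] E).rangeRestrict.prodMap LinearMap.id
  have hf : Function.Surjective f :=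
    (A : E →ₗ[ℝ] E).surjective_rangeRestrict.prodMap Function.surjective_id
  rw [tripleSig_eq_quadSig, ← quadSig_comp_of_surjective _ hf]
  rfl

theorem continuous_pullbackForm (M N : Submodule ℝ E) :
    Continuous fun q : (E →L[ℝ] E) × (E × M × N) => pullbackForm ω M N q.1 q.2 := by
  have h : (fun q : (E →L[ℝ] E) × (E × M × N) => pullbackForm ω M N q.1 q.2) = fun q =>
      ω.toContinuousBilinearMap (q.1 q.2.1) q.2.2.1
        + ω.toContinuousBilinearMap (q.2.2.1 : E) q.2.2.2
        + ω.toContinuousBilinearMap (q.2.2.2 : E) (q.1 q.2.1) := rfl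
  rw [h]
  fun_prop

theorem eventually_sigPos_le {X V : Type*} [TopologicalSpace X] [NormedAddCommGroup V]
    [NormedSpace ℝ V] [FiniteDimensional ℝ V] {Q : X → QuadraticForm ℝ V}
    (hQ : Continuous fun q : X × V => Q q.1 q.2) (x₀ : X) :
    ∀ᶠ x in nhds x₀, sigPos (Q x₀) ≤ sigPos (Q x) := by
  obtain ⟨S, hS, hpos⟩ := exists_finrank_eq_sigPos (Q x₀)
  have hK : IsCompact ((S : Set V) ∩ Metric.sphere 0 1) :=
    (isCompact_sphere 0 1).inter_left S.closed_of_finiteDimensional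
  have hev : ∀ᶠ x in nhds x₀, ∀ v ∈ (S : Set V) ∩ Metric.sphere 0 1, 0 < Q x v := by
    refine hK.eventually_forall_of_forall_eventually fun v hv => ?_
    refine hQ.continuousAt.eventually (lt_mem_nhds (hpos v hv.1 ?_))
    exact ne_zero_of_mem_unit_sphere ⟨v, hv.2⟩
  filter_upwards [hev] with x hx
  rw [← hS]
  apply le_sigPos
  intro v hv hv0
  have h := hx (‖v‖⁻¹ • v) ⟨S.smul_mem _ hv, by simp [norm_smul, hv0]⟩
  rw [QuadraticMap.map_smul] at h
  exact pos_of_mul_pos_right h (by positivity)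

theorem eventually_quadSig_pullbackForm_eq (halt : LinearMap.IsAlt ω)
    (hnd : LinearMap.BilinForm.Nondegenerate ω) {M N : Submodule ℝ E}
    (hM : IsLagrangian ω M) (hN : IsLagrangian ω N) {A₀ : E →L[ℝ] E}
    (hA₀ : IsLagrangian ω (LinearMap.range (A₀ : E →ₗ[ℝ] E)))
    (hMA₀ : M ⊓ LinearMap.range (A₀ : E →ₗ[ℝ] E) = ⊥)
    (hNA₀ : N ⊓ LinearMap.range (A₀ : E →ₗ[ℝ] E) = ⊥) :
    ∀ᶠ A : E →L[ℝ] E in nhds A₀, IsLagrangian ω (LinearMap.range (A : E →ₗ[ℝ] E)) →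
      M ⊓ LinearMap.range (A : E →ₗ[ℝ] E) = ⊥ → N ⊓ LinearMap.range (A : E →ₗ[ℝ] E) = ⊥ →
      quadSig (pullbackForm ω M N A) = quadSig (pullbackForm ω M N A₀) := by
  have hcont := continuous_pullbackForm (ω := ω) M N
  filter_upwards [eventually_sigPos_le hcont A₀,
    eventually_sigPos_le (Q := fun A => -pullbackForm ω M N A) hcont.neg A₀] with A hp hn hA hMA hNA
  have h := QuadraticForm.sigPos_add_sigNeg_add_radical (Q := pullbackForm ω M N A)
  have h₀ := QuadraticForm.sigPos_add_sigNeg_add_radical (Q := pullbackForm ω M N A₀)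
  rw [radical_pullbackForm halt hA hM hN hMA hNA, finrank_submodule_prod] at h
  rw [radical_pullbackForm halt hA₀ hM hN hMA₀ hNA₀, finrank_submodule_prod] at h₀
  have := hA.two_mul_finrank hnd
  have := hA₀.two_mul_finrank hnd
  have := LinearMap.finrank_range_add_finrank_ker (A : E →ₗ[ℝ] E)
  have := LinearMap.finrank_range_add_finrank_ker (A₀ : E →ₗ[ℝ] E)
  simp only [sigPos_neg] at hn
  simp only [quadSig]
  lia

theorem IsLagrangianPath.tripleSig_eq (halt : LinearMap.IsAlt ω)
    (hnd : LinearMap.BilinForm.Nondegenerate ω) {a b : ℝ} {L : ℝ → Submodule ℝ E}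
    (hL : IsLagrangianPath ω a b L) {M N : Submodule ℝ E} (hM : IsLagrangian ω M)
    (hN : IsLagrangian ω N) {I : Set ℝ} (hI : IsPreconnected I) (hIab : I ⊆ Set.Icc a b)
    (hML : ∀ s ∈ I, M ⊓ L s = ⊥) (hNL : ∀ s ∈ I, N ⊓ L s = ⊥) {x y : ℝ} (hx : x ∈ I)
    (hy : y ∈ I) : tripleSig ω (L x) M N = tripleSig ω (L y) M N := by
  refine hI.constant (f := fun s => tripleSig ω (L s) M N) (fun s hs => ?_) hx hy
  obtain ⟨U, hU, -, P, hPcont, hP⟩ := hL.locTriv s (hIab hs)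
  have hUI : U ∈ nhdsWithin s I := nhdsWithin_mono s hIab hU
  have hsU : s ∈ U := mem_of_mem_nhdsWithin hs hUI
  have hrange : ∀ t ∈ U, LinearMap.range (P t : E →ₗ[ℝ] E) = L t := fun t ht => (hP t ht).2
  have hPs : Filter.Tendsto P (nhdsWithin s I) (nhds (P s)) :=
    (hPcont s hsU).mono_left (nhdsWithin_le_of_mem hUI)
  have hs' := hL.lag s (hIab hs)
  have hMs := hML s hs
  have hNs := hNL s hs
  rw [← hrange s hsU] at hs' hMs hNs
  refine Filter.Tendsto.congr' (f₁ := fun _ => tripleSig ω (L s) M N) ?_ tendsto_const_nhds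
  filter_upwards [hPs.eventually (eventually_quadSig_pullbackForm_eq halt hnd hM hN hs' hMs hNs),
    hUI, self_mem_nhdsWithin] with t ht htU htI
  rw [quadSig_pullbackForm, quadSig_pullbackForm, hrange t htU, hrange s hsU] at ht
  exact (ht (hL.lag t (hIab htI)) (hML t htI) (hNL t htI)).symm

end Continuity

section Partition

theorem le_of_forall_le_succ {t : ℕ → ℝ} {k : ℕ} (ht : ∀ ν < k, t ν ≤ t (ν + 1)) {i j : ℕ}
    (hij : i ≤ j) (hj : j ≤ k) : t i ≤ t j := by
  induction j, hij using Nat.le_induction with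
  | base => rfl
  | succ j _ ih => exact (ih (by lia)).trans (ht j (by lia))

theorem sum_sub_eq_sum_sub {a b : ℝ} {k k' : ℕ} {t t' : ℕ → ℝ} (S S' : ℕ → ℝ → ℝ)
    (ht0 : t 0 = a) (htk : t k = b) (ht : ∀ ν < k, t ν ≤ t (ν + 1))
    (ht0' : t' 0 = a) (htk' : t' k' = b) (ht' : ∀ μ < k', t' μ ≤ t' (μ + 1))
    (h : ∀ ν < k, ∀ μ < k', ∀ x ∈ Set.Icc (t ν) (t (ν + 1)) ∩ Set.Icc (t' μ) (t' (μ + 1)),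
      ∀ y ∈ Set.Icc (t ν) (t (ν + 1)) ∩ Set.Icc (t' μ) (t' (μ + 1)),
      S ν x - S ν y = S' μ x - S' μ y) :
    ∑ ν ∈ Finset.range k, (S ν (t ν) - S ν (t (ν + 1))) =
      ∑ μ ∈ Finset.range k', (S' μ (t' μ) - S' μ (t' (μ + 1))) := by
  let c (t : ℕ → ℝ) (ν : ℕ) (s : ℝ) : ℝ := max (t ν) (min s (t (ν + 1)))
  have split {k k' : ℕ} {t t' : ℕ → ℝ} (S : ℕ → ℝ → ℝ) (ht : ∀ ν < k, t ν ≤ t (ν + 1))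
      (h0 : t 0 = t' 0) (hk : t k = t' k') :
      ∑ ν ∈ Finset.range k, (S ν (t ν) - S ν (t (ν + 1))) = ∑ ν ∈ Finset.range k,
        ∑ μ ∈ Finset.range k', (S ν (c t ν (t' μ)) - S ν (c t ν (t' (μ + 1)))) := by
    refine Finset.sum_congr rfl fun ν hν => ?_
    have hν := Finset.mem_range.1 hν
    have h1 : t' 0 ≤ t ν := h0 ▸ le_of_forall_le_succ ht (Nat.zero_le ν) hν.le
    have h2 : t (ν + 1) ≤ t' k' := hk ▸ le_of_forall_le_succ ht hν le_rfl
    rw [Finset.sum_range_sub' (fun μ => S ν (c t ν (t' μ)))]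
    simp only [c]
    rw [min_eq_right h2, max_eq_right (ht ν hν), max_eq_left ((min_le_left _ _).trans h1)]
  rw [split S ht (ht0.trans ht0'.symm) (htk.trans htk'.symm),
    split S' ht' (ht0'.trans ht0.symm) (htk'.trans htk.symm), Finset.sum_comm]
  refine Finset.sum_congr rfl fun μ hμ => Finset.sum_congr rfl fun ν hν => ?_
  have hμ := Finset.mem_range.1 hμ
  have hν := Finset.mem_range.1 hν
  have h1 := ht ν hν
  have h2 := ht' μ hμ
  rcases lt_or_ge (t (ν + 1)) (t' μ) with h3 | h3
  · have e1 : c t ν (t' μ) = c t ν (t' (μ + 1)) := by grind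
    have e2 : c t' μ (t ν) = c t' μ (t (ν + 1)) := by grind
    rw [e1, e2, sub_self, sub_self]
  rcases lt_or_ge (t' (μ + 1)) (t ν) with h4 | h4
  · have e1 : c t ν (t' μ) = c t ν (t' (μ + 1)) := by grind
    have e2 : c t' μ (t ν) = c t' μ (t (ν + 1)) := by grind
    rw [e1, e2, sub_self, sub_self]
  have e1 : c t' μ (t ν) = c t ν (t' μ) := by grind
  have e2 : c t' μ (t (ν + 1)) = c t ν (t' (μ + 1)) := by grind
  rw [e1, e2]
  refine h ν hν μ hμ _ ⟨?_, ?_⟩ _ ⟨?_, ?_⟩ <;> constructor <;> grind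

end Partition

/-- antisymmetry of the intersection number: `[L1 : L2] + [L2 : L1] = 0`, where
each intersection number is computed from an arbitrary choice of admissible data. -/
theorem intersection_number_antisymm [FiniteDimensional ℝ E]
    (ω : BilinForm ℝ E) (halt : LinearMap.IsAlt ω)
    (hnd : LinearMap.BilinForm.Nondegenerate ω)
    (a b : ℝ) (hab : a ≤ b)
    (L1 L2 : ℝ → Submodule ℝ E)
    (h1 : IsLagrangianPath ω a b L1) (h2 : IsLagrangianPath ω a b L2)
    (D12 : AdmissibleData ω a b L1 L2) (D21 : AdmissibleData ω a b L2 L1) :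
    dataSum D12 + dataSum D21 = 0 := by
  have hkey : ∑ ν ∈ Finset.range D12.k,
      ((tripleSig ω (L1 (D12.t ν)) (L2 (D12.t ν)) (D12.M (ν + 1)) : ℝ)
        - (tripleSig ω (L1 (D12.t (ν + 1))) (L2 (D12.t (ν + 1))) (D12.M (ν + 1)) : ℝ)) =
      ∑ μ ∈ Finset.range D21.k,
      (-(tripleSig ω (L2 (D21.t μ)) (L1 (D21.t μ)) (D21.M (μ + 1)) : ℝ)
        - -(tripleSig ω (L2 (D21.t (μ + 1))) (L1 (D21.t (μ + 1))) (D21.M (μ + 1)) : ℝ)) := by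
    refine sum_sub_eq_sum_sub
      (fun ν s => (tripleSig ω (L1 s) (L2 s) (D12.M (ν + 1)) : ℝ))
      (fun μ s => -(tripleSig ω (L2 s) (L1 s) (D21.M (μ + 1)) : ℝ))
      D12.ht0 D12.htk D12.hmono D21.ht0 D21.htk D21.hmono fun ν hν μ hμ x hx y hy => ?_
    have hM := D12.hlag ν hν
    have hN := D21.hlag μ hμ
    have hM1 := D12.htrans1 ν hν
    have hM2 := D12.htrans2 ν hν
    have hN1 := D21.htrans2 μ hμ
    have hN2 := D21.htrans1 μ hμ
    have hlow : a ≤ D12.t ν :=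
      D12.ht0.symm.trans_le (le_of_forall_le_succ D12.hmono (Nat.zero_le ν) hν.le)
    have hup : D12.t (ν + 1) ≤ b :=
      (le_of_forall_le_succ D12.hmono hν le_rfl).trans_eq D12.htk
    have hsub : Set.Icc (D12.t ν) (D12.t (ν + 1)) ∩ Set.Icc (D21.t μ) (D21.t (μ + 1)) ⊆
        Set.Icc a b := Set.inter_subset_left.trans (Set.Icc_subset_Icc hlow hup)
    have hconn := (Set.ordConnected_Icc.inter Set.ordConnected_Icc :
      (Set.Icc (D12.t ν) (D12.t (ν + 1)) ∩
        Set.Icc (D21.t μ) (D21.t (μ + 1))).OrdConnected).isPreconnected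
    have c1 := h1.tripleSig_eq halt hnd hN hM hconn hsub (fun s hs => hN1 s hs.2)
      (fun s hs => hM1 s hs.1) hx hy
    have c2 := h2.tripleSig_eq halt hnd hN hM hconn hsub (fun s hs => hN2 s hs.2)
      (fun s hs => hM2 s hs.1) hx hy
    have cocycle (s) (hs : s ∈ Set.Icc (D12.t ν) (D12.t (ν + 1)) ∩
        Set.Icc (D21.t μ) (D21.t (μ + 1))) :=
      tripleSig_add_tripleSig halt hnd (h1.lag s (hsub hs)) (h2.lag s (hsub hs)) hM hN
        (hM1 s hs.1) (hM2 s hs.1) (hN1 s hs.2)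
    have cx := cocycle x hx
    have cy := cocycle y hy
    rw [tripleSig_swap halt (L1 x) (L2 x), tripleSig_swap halt (L1 y) (L2 y)]
    norm_cast
    lia
  rw [dataSum, dataSum, hkey, ← mul_add, ← Finset.sum_add_distrib]
  simp
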